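/- arXiv:2501.03673 — 2 statements merged into one kernel-verified Lean document; each statement's English description precedes it below -/
import Mathlib

section
/- M^E is an F-linear subspace of M, and it has dimension exactly 1 as an F-vector space. (Lemma A.2 of the paper.) -/
open TensorProduct

/-- For `E / K` essentially of finite type and formally unramified inside `F`,
the `F`-algebra `F ⊗[K] E` contains an element on which both actions of `E` agree and
which multiplication sends to `1`. -/
lemma exists_tmul_one_mul_eq_one_tmul_mul (K E F : Type*) [Field K] [Field E] [Field F]
    [Algebra K E] [Algebra K F] [Algebra E F] [IsScalarTower K E F]
    [Algebra.EssFiniteType K E] [Algebra.FormallyUnramified K E] :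
    ∃ t : F ⊗[K] E,
      (∀ x : E, (algebraMap E F x ⊗ₜ[K] (1 : E)) * t = ((1 : F) ⊗ₜ[K] x) * t) ∧
      Algebra.TensorProduct.lift (AlgHom.id F F) (IsScalarTower.toAlgHom K E F)
        (fun _ _ => Commute.all _ _) t = 1 := by
  let φ : E ⊗[K] E →ₐ[K] F ⊗[K] E :=
    Algebra.TensorProduct.map (IsScalarTower.toAlgHom K E F) (AlgHom.id K E)
  let μ : F ⊗[K] E →ₐ[F] F := Algebra.TensorProduct.lift (AlgHom.id F F)
    (IsScalarTower.toAlgHom K E F) (fun _ _ => Commute.all _ _)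
  have hμφ : ∀ y : E ⊗[K] E, μ (φ y) = algebraMap E F (Algebra.TensorProduct.lmul' K y) := by
    intro y
    induction y with
    | zero => simp
    | tmul a b => simp [μ, φ]
    | add a b ha hb => simp only [map_add, ha, hb]
  refine ⟨φ (Algebra.FormallyUnramified.elem K E), fun x => ?_, ?_⟩
  · have h := congrArg φ (Algebra.FormallyUnramified.one_tmul_mul_elem (R := K) x)
    simpa [φ] using h.symm
  · refine (hμφ _).trans ?_
    rw [Algebra.FormallyUnramified.lmul_elem, map_one]

/-- If both actions of `E` on `m` agree, then `F ⊗[K] E` acts on `m` through multiplication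
`F ⊗[K] E → F`. -/
lemma smul_eq_lift_smul {K E F M : Type*} [Field K] [Field E] [Field F]
    [Algebra K E] [Algebra K F] [Algebra E F] [IsScalarTower K E F]
    [AddCommGroup M] [Module (F ⊗[K] E) M] [Module F M] [IsScalarTower F (F ⊗[K] E) M] {m : M}
    (hm : ∀ x : E, (algebraMap E F x ⊗ₜ[K] (1 : E)) • m = ((1 : F) ⊗ₜ[K] x) • m)
    (y : F ⊗[K] E) :
    y • m = Algebra.TensorProduct.lift (AlgHom.id F F) (IsScalarTower.toAlgHom K E F)
      (fun _ _ => Commute.all _ _) y • m := by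
  induction y with
  | zero => simp
  | tmul a b =>
    have h : a ⊗ₜ[K] b = a • ((1 : F) ⊗ₜ[K] b) := by simp [TensorProduct.smul_tmul']
    have h' : algebraMap E F b ⊗ₜ[K] (1 : E) = algebraMap E F b • (1 : F ⊗[K] E) := by
      rw [Algebra.TensorProduct.one_def, TensorProduct.smul_tmul', smul_eq_mul, mul_one]
    rw [h, smul_assoc, ← hm, h', smul_assoc, one_smul, smul_smul]
    simp
  | add a b ha hb => rw [add_smul, ha, hb, map_add, add_smul]

/-- Lemma A.2 of the paper.
Let `K ⊆ E ⊆ F` be field extensions with `char K = 0` and `F` finite over `K`, and let `M` be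
a free module of rank one over `F ⊗[K] E` (witnessed by the linear equivalence `e`).  Regarding
`M` as an `F`-vector space via `x ↦ x ⊗ 1` (the hypotheses `Module F M` and
`IsScalarTower F (F ⊗[K] E) M`), the set
`M^E = {m : M | (x ⊗ 1) • m = (1 ⊗ x) • m for all x ∈ E}` is an `F`-linear subspace of `M`
of dimension exactly `1`. -/
theorem stmt3 (K E F : Type*) [Field K] [Field E] [Field F] [CharZero K]
    [Algebra K E] [Algebra K F] [Algebra E F] [IsScalarTower K E F]
    [FiniteDimensional K F]
    (M : Type*) [AddCommGroup M] [Module (F ⊗[K] E) M] [Module F M]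
    [IsScalarTower F (F ⊗[K] E) M]
    (e : M ≃ₗ[F ⊗[K] E] F ⊗[K] E) :
    ∃ S : Submodule F M,
      (S : Set M) = {m : M | ∀ x : E,
        ((algebraMap E F x) ⊗ₜ[K] (1 : E) : F ⊗[K] E) • m
          = ((1 : F) ⊗ₜ[K] x : F ⊗[K] E) • m} ∧
      Module.finrank F S = 1 := by
  have : FiniteDimensional K E := FiniteDimensional.left K E F
  have : Algebra.FormallyUnramified K E := .of_isSeparable K E
  obtain ⟨t, ht, ht1⟩ := exists_tmul_one_mul_eq_one_tmul_mul K E F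
  have hmem : ∀ x : E, (algebraMap E F x ⊗ₜ[K] (1 : E)) • e.symm t
      = ((1 : F) ⊗ₜ[K] x) • e.symm t := fun x => by
    rw [← map_smul, ← map_smul, smul_eq_mul, smul_eq_mul, ht]
  have ht0 : t ≠ 0 := by
    rintro rfl
    simp at ht1
  refine ⟨Submodule.span F {e.symm t}, ?_, finrank_span_singleton (by simpa using ht0)⟩
  ext m
  rw [SetLike.mem_coe, Submodule.mem_span_singleton, Set.mem_ofPred_eq]
  constructor
  · rintro ⟨a, rfl⟩ x
    rw [← algebraMap_smul (F ⊗[K] E) a, smul_comm, hmem, smul_comm]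
  · intro hm
    have key : t • m = e m • e.symm t := by
      apply e.injective
      simp [mul_comm]
    refine ⟨_, (smul_eq_lift_smul hmem (e m)).symm.trans (key.symm.trans ?_)⟩
    rw [smul_eq_lift_smul hm, ht1, one_smul]
end

section
/- The E-vector space E{φ} is 1-dimensional. In particular, there exists a nonzero element 𝔤(φ) ∈ E{φ}, any such element lies in Lˣ, and any two nonzero elements of E{φ} differ by multiplication by an element of Eˣ. (This is the assertion of §4.2 of the paper underlying the definition of the generalized Gauss sum 𝔤(φ), and it also gives the uniqueness statement used in the proof of Lemma 4.1.) -/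
/-- The eigenspace `E{φ} = {x ∈ L | σ(x) = φ(σ)·x for all σ ∈ Gal(L/E)}`, an `E`-linear
subspace of `L`. -/
def gaussEigenspace (E L : Type*) [Field E] [Field L] [Algebra E L]
    (φ : (L ≃ₐ[E] L) →* Eˣ) : Submodule E L where
  carrier := {x : L | ∀ σ : L ≃ₐ[E] L, σ x = (φ σ : E) • x}
  zero_mem' := by intro σ; simp
  add_mem' := by
    intro a b ha hb σ
    simp only [map_add, ha σ, hb σ, smul_add]
  smul_mem' := by
    intro c a ha σ
    rw [map_smul, ha σ, smul_comm]

theorem exists_ne_zero_mem_gaussEigenspace (E L : Type*) [Field E] [Field L] [Algebra E L]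
    [FiniteDimensional E L] (φ : (L ≃ₐ[E] L) →* Eˣ) :
    ∃ g : L, g ∈ gaussEigenspace E L φ ∧ g ≠ 0 := by
  obtain ⟨β, hβ⟩ := groupCohomology.isMulCoboundary₁_of_isMulCocycle₁_of_aut_to_units
    (fun σ : L ≃ₐ[E] L => Units.map (algebraMap E L).toMonoidHom (φ σ)) (by
      intro σ τ
      ext
      simp [mul_comm])
  refine ⟨β, fun σ => ?_, β.ne_zero⟩
  rw [Algebra.smul_def]
  simpa using congrArg Units.val (div_eq_iff_eq_mul.mp (hβ σ))

theorem exists_units_smul_eq_of_mem_gaussEigenspace {E L : Type*} [Field E] [Field L]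
    [Algebra E L] [FiniteDimensional E L] [IsGalois E L] {φ : (L ≃ₐ[E] L) →* Eˣ} {x y : L}
    (hx : x ∈ gaussEigenspace E L φ) (hy : y ∈ gaussEigenspace E L φ)
    (hx0 : x ≠ 0) (hy0 : y ≠ 0) : ∃ c : Eˣ, y = (c : E) • x := by
  obtain ⟨c, hc⟩ := (IsGalois.mem_range_algebraMap_iff_fixed (F := E) (y / x)).mpr fun σ => by
    have hφ : algebraMap E L (φ σ) ≠ 0 := by simp
    rw [map_div₀, hx σ, hy σ, Algebra.smul_def, Algebra.smul_def, mul_div_mul_left _ _ hφ]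
  have hc0 : c ≠ 0 := by
    rintro rfl
    rw [map_zero] at hc
    exact div_ne_zero hy0 hx0 hc.symm
  refine ⟨Units.mk0 c hc0, ?_⟩
  rw [Units.val_mk0, Algebra.smul_def, hc, div_mul_cancel₀ _ hx0]

/-- §4.2 of the paper.
Let `L/E` be a finite Galois extension with Galois group `G = Gal(L/E)` and `φ : G → Eˣ`
a character.  The `E`-vector space `E{φ}` is `1`-dimensional; in particular there is a nonzero
element `𝔤(φ)` of `E{φ}`, every such nonzero element is a unit of `L`, and any two nonzero
elements of `E{φ}` differ by multiplication by an element of `Eˣ`. -/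
theorem stmt4 (E L : Type*) [Field E] [Field L] [Algebra E L]
    [FiniteDimensional E L] [IsGalois E L] (φ : (L ≃ₐ[E] L) →* Eˣ) :
    Module.finrank E (gaussEigenspace E L φ) = 1 ∧
    (∃ g : L, g ∈ gaussEigenspace E L φ ∧ g ≠ 0) ∧
    (∀ x : L, x ∈ gaussEigenspace E L φ → x ≠ 0 → IsUnit x) ∧
    (∀ x y : L, x ∈ gaussEigenspace E L φ → y ∈ gaussEigenspace E L φ →
      x ≠ 0 → y ≠ 0 → ∃ c : Eˣ, y = (c : E) • x) := by
  obtain ⟨g, hg, hg0⟩ := exists_ne_zero_mem_gaussEigenspace E L φ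
  refine ⟨finrank_eq_one (⟨g, hg⟩ : gaussEigenspace E L φ) ?_ ?_, ⟨g, hg, hg0⟩,
    fun x _ hx0 => hx0.isUnit,
    fun x y hx hy hx0 hy0 => exists_units_smul_eq_of_mem_gaussEigenspace hx hy hx0 hy0⟩
  · exact fun h => hg0 (congrArg Subtype.val h)
  · rintro ⟨y, hy⟩
    by_cases hy0 : y = 0
    · exact ⟨0, Subtype.ext (by simp [hy0])⟩
    · obtain ⟨c, hc⟩ := exists_units_smul_eq_of_mem_gaussEigenspace hg hy hg0 hy0
      exact ⟨c, Subtype.ext hc.symm⟩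
end
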